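/- Suppose G is a Finsler-type energy on ℝ^n and Φ defines a regular bounded domain Ω with constant δ₀. If x is a non-constant V⁻-critical curve of J on Mf, then ẋ(0) and ẋ(1) are orthogonal to ∂Ω in the Finsler sense: d_vG(x(0),ẋ(0))[w] = 0 for every w ∈ ℝ^n with ⟨∇Φ(x(0)),w⟩ = 0, and d_vG(x(1),ẋ(1))[w] = 0 for every w ∈ ℝ^n with ⟨∇Φ(x(1)),w⟩ = 0. -/

import Mathlib

open MeasureTheory Set Filter RealInnerProductSpace

noncomputable section

/-- Euclidean space `ℝ^n`. -/
abbrev Evec (n : ℕ) := EuclideanSpace ℝ (Fin n)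

/-- An `H¹` curve on `[a,b]`: an absolutely continuous curve whose a.e. derivative is
square-integrable, encoded by a choice of (integrable, square-integrable) derivative
together with the fundamental theorem of calculus identity. -/
structure H1Curve (n : ℕ) (a b : ℝ) where
  toFun : ℝ → Evec n
  deriv : ℝ → Evec n
  deriv_integrable : IntegrableOn deriv (Icc a b)
  deriv_sq_integrable : IntegrableOn (fun s => ‖deriv s‖ ^ 2) (Icc a b)
  eq_add_integral : ∀ t ∈ Icc a b, toFun t = toFun a + ∫ s in a..t, deriv s

/-- The partial differential `d_qG(q,v)` of `G` in the first variable. -/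
def dqCLM {n : ℕ} (G : Evec n → Evec n → ℝ) (q v : Evec n) : Evec n →L[ℝ] ℝ :=
  fderiv ℝ (fun z => G z v) q

/-- The partial differential `d_vG(q,v)` of `G` in the second variable. -/
def dvCLM {n : ℕ} (G : Evec n → Evec n → ℝ) (q v : Evec n) : Evec n →L[ℝ] ℝ :=
  fderiv ℝ (fun w => G q w) v

/-- A Finsler-type energy on `ℝ^n` with constants `ℓ ≥ 1` and `α > 0`. -/
structure IsFinslerEnergy (n : ℕ) (G : Evec n → Evec n → ℝ) (ℓ α : ℝ) : Prop where
  continuous : Continuous fun p : Evec n × Evec n => G p.1 p.2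
  smooth : ContDiffOn ℝ 2 (fun p : Evec n × Evec n => G p.1 p.2) {p | p.2 ≠ 0}
  homog : ∀ (q v : Evec n) (lam : ℝ), 0 < lam → G q (lam • v) = lam ^ 2 * G q v
  one_le_ell : 1 ≤ ℓ
  alpha_pos : 0 < α
  lower : ∀ q v, (1 / ℓ) * ‖v‖ ^ 2 ≤ G q v
  upper : ∀ q v, G q v ≤ ℓ * ‖v‖ ^ 2
  dq_bound : ∀ q v, ‖dqCLM G q v‖ ≤ ℓ * (1 + ‖v‖ ^ 2)
  dv_bound : ∀ q v, ‖dvCLM G q v‖ ≤ ℓ * (1 + ‖v‖)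
  vv_convex : ∀ (q v : Evec n), v ≠ 0 → ∀ w : Evec n,
    α * ‖w‖ ^ 2 ≤ fderiv ℝ (fun u => dvCLM G q u w) v w

/-- `Φ` defines a regular bounded domain `Ω = Φ⁻¹((−∞,0))` with constant `δ₀`. -/
structure IsRegularDomain (n : ℕ) (Φ : Evec n → ℝ) (δ₀ : ℝ) : Prop where
  smooth : ContDiff ℝ 2 Φ
  nonempty : (Φ ⁻¹' Iio 0).Nonempty
  bounded : Bornology.IsBounded (Φ ⁻¹' Iio 0)
  boundary_eq : frontier (Φ ⁻¹' Iio 0) = Φ ⁻¹' {0}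
  delta0_pos : 0 < δ₀
  grad_ne_zero : ∀ q : Evec n, |Φ q| ≤ δ₀ → gradient Φ q ≠ 0
  sublevel_compact : ∀ δ ∈ Icc (0:ℝ) δ₀, IsCompact (Φ ⁻¹' Iic δ)

/-- Membership in `Mf`: curves in `Ω̄` with endpoints on `∂Ω`. -/
def MemMf {n : ℕ} (Φ : Evec n → ℝ) (x : H1Curve n 0 1) : Prop :=
  (∀ s ∈ Icc (0:ℝ) 1, Φ (x.toFun s) ≤ 0) ∧ Φ (x.toFun 0) = 0 ∧ Φ (x.toFun 1) = 0

/-- Membership in `V⁻(x,Mf)`. -/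
def MemVminus {n : ℕ} (Φ : Evec n → ℝ) (x ξ : H1Curve n 0 1) : Prop :=
  ⟪gradient Φ (x.toFun 0), ξ.toFun 0⟫ = 0 ∧
  ⟪gradient Φ (x.toFun 1), ξ.toFun 1⟫ = 0 ∧
  ∀ s ∈ Ioo (0:ℝ) 1, Φ (x.toFun s) = 0 → ⟪gradient Φ (x.toFun s), ξ.toFun s⟫ ≤ 0

/-- Membership in `W⁻(x,Mf)`: as `V⁻` but with strict inequality at interior touching points. -/
def MemWminus {n : ℕ} (Φ : Evec n → ℝ) (x ξ : H1Curve n 0 1) : Prop :=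
  MemVminus Φ x ξ ∧
  ∀ s ∈ Ioo (0:ℝ) 1, Φ (x.toFun s) = 0 → ⟪gradient Φ (x.toFun s), ξ.toFun s⟫ < 0

/-- The energy functional `J(x) = (1/2)∫₀¹ G(x,ẋ)`. -/
def energy {n : ℕ} (G : Evec n → Evec n → ℝ) (x : H1Curve n 0 1) : ℝ :=
  (1 / 2) * ∫ s in (0:ℝ)..1, G (x.toFun s) (x.deriv s)

/-- The differential `dJ(x)[ξ]`. -/
def dJ {n : ℕ} (G : Evec n → Evec n → ℝ) (x ξ : H1Curve n 0 1) : ℝ :=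
  (1 / 2) * ∫ s in (0:ℝ)..1,
    (dqCLM G (x.toFun s) (x.deriv s) (ξ.toFun s) + dvCLM G (x.toFun s) (x.deriv s) (ξ.deriv s))

/-- `x` is a `V⁻`-critical curve for `J` on `Mf`. -/
def IsVCritical {n : ℕ} (G : Evec n → Evec n → ℝ) (Φ : Evec n → ℝ) (x : H1Curve n 0 1) : Prop :=
  MemMf Φ x ∧ ∀ ξ : H1Curve n 0 1, MemVminus Φ x ξ → 0 ≤ dJ G x ξ

/-- The norm `‖ξ‖_*`. -/
def starNorm {n : ℕ} (ξ : H1Curve n 0 1) : ℝ :=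
  max ‖ξ.toFun 0‖ ‖ξ.toFun 1‖ + Real.sqrt (∫ s in (0:ℝ)..1, ‖ξ.deriv s‖ ^ 2)

/-- The distance `dist_*`. -/
def starDist {n : ℕ} (x y : H1Curve n 0 1) : ℝ :=
  max ‖x.toFun 0 - y.toFun 0‖ ‖x.toFun 1 - y.toFun 1‖ +
    Real.sqrt (∫ s in (0:ℝ)..1, ‖x.deriv s - y.deriv s‖ ^ 2)

/-- The penalization function `χ_δ`. -/
def chi (δ t : ℝ) : ℝ := if t ≤ 0 then 0 else t ^ 2 / (δ - t) ^ 2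

/-- Membership in `C_δ = C([a,b],p,q,Ω_δ)`. -/
def MemC {n : ℕ} (Φ : Evec n → ℝ) (δ a b : ℝ) (p q : Evec n) (γ : H1Curve n a b) : Prop :=
  (∀ s ∈ Icc a b, Φ (γ.toFun s) < δ) ∧ γ.toFun a = p ∧ γ.toFun b = q

/-- The penalized functional `J_δ`. -/
def Jpen {n : ℕ} (G : Evec n → Evec n → ℝ) (Φ : Evec n → ℝ) (δ a b : ℝ)
    (γ : H1Curve n a b) : ℝ :=
  (1 / 2) * (∫ s in a..b, G (γ.toFun s) (γ.deriv s)) + ∫ s in a..b, chi δ (Φ (γ.toFun s))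

/-- `y` represents the backward parametrization `ℛx` of `x` (on `[0,1]`). -/
def RevRep {n : ℕ} (x y : H1Curve n 0 1) : Prop :=
  (∀ s, y.toFun s = x.toFun (1 - s)) ∧ (∀ s, y.deriv s = -x.deriv (1 - s))

set_option linter.unusedSectionVars false
/-- The first function is a primitive of the second on the unit interval. -/
def PrimOn {E : Type*} [NormedAddCommGroup E] [NormedSpace ℝ E] (Y Y' : ℝ → E) : Prop :=
  IntegrableOn Y' (Icc (0:ℝ) 1) ∧ ∀ t ∈ Icc (0:ℝ) 1, Y t = Y 0 + ∫ s in (0:ℝ)..t, Y' s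

section Prim
variable {E F : Type*} [NormedAddCommGroup E] [NormedSpace ℝ E] [CompleteSpace E]
  [NormedAddCommGroup F] [NormedSpace ℝ F] [CompleteSpace F]

lemma ac_of_dist_le {f : ℝ → E} {M : ℝ → ℝ} {K a b : ℝ} 
    (hM : AbsolutelyContinuousOnInterval M a b)
    (h : ∀ s ∈ uIcc a b, ∀ t ∈ uIcc a b, dist (f s) (f t) ≤ K * dist (M s) (M t)) :
    AbsolutelyContinuousOnInterval f a b := by
  have h1 := (show Tendsto _ _ _ from hM).const_mul K
  rw [mul_zero] at h1
  refine squeeze_zero' ?_ ?_ h1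
  · exact Eventually.of_forall fun E => Finset.sum_nonneg (fun _ _ => dist_nonneg)
  · filter_upwards [eventually_inf_principal.mpr (Eventually.of_forall fun E hE => hE)] with E hE
    rw [Finset.mul_sum]
    refine Finset.sum_le_sum fun i hi => ?_
    have := hE.1 i hi
    exact h _ this.1 _ this.2

lemma intInt_of_on {f : ℝ → E} (h : IntegrableOn f (Icc (0:ℝ) 1)) {a b : ℝ}
    (ha : a ∈ Icc (0:ℝ) 1) (hb : b ∈ Icc (0:ℝ) 1) : IntervalIntegrable f volume a b := by
  rw [intervalIntegrable_iff]
  exact h.mono_set (uIoc_subset_uIcc.trans (uIcc_subset_Icc ha hb))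

lemma PrimOn.sub_eq {Y Y' : ℝ → E} (h : PrimOn Y Y') {a b : ℝ}
    (ha : a ∈ Icc (0:ℝ) 1) (hb : b ∈ Icc (0:ℝ) 1) : Y b - Y a = ∫ s in a..b, Y' s := by
  rw [h.2 a ha, h.2 b hb, ← intervalIntegral.integral_interval_sub_left
    (intInt_of_on h.1 (a := 0) (by simp) hb) (intInt_of_on h.1 (a := 0) (by simp) ha)]
  abel

lemma PrimOn.ac {Y Y' : ℝ → E} (h : PrimOn Y Y') : AbsolutelyContinuousOnInterval Y 0 1 := by
  have hn : IntegrableOn (fun s => ‖Y' s‖) (Icc (0:ℝ) 1) := h.1.norm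
  have h0 : (0:ℝ) ∈ Icc (0:ℝ) 1 := by simp
  have h1 : (1:ℝ) ∈ Icc (0:ℝ) 1 := by simp
  refine ac_of_dist_le (K := 1) ((intInt_of_on hn h0 h1).absolutelyContinuousOnInterval_intervalIntegral
    (c := 0) (by simp)) ?_
  intro s hs t ht
  rw [uIcc_of_le zero_le_one] at hs ht
  rw [one_mul, dist_comm, dist_comm (∫ v in (0:ℝ)..s, _), dist_eq_norm, h.sub_eq hs ht, Real.dist_eq,
    intervalIntegral.integral_interval_sub_left (intInt_of_on hn h0 ht) (intInt_of_on hn h0 hs)]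
  exact intervalIntegral.norm_integral_le_abs_integral_norm

lemma PrimOn.continuousOn {Y Y' : ℝ → E} (h : PrimOn Y Y') : ContinuousOn Y (Icc 0 1) := by
  simpa [uIcc_of_le] using h.ac.continuousOn

lemma PrimOn.ae_deriv {Y Y' : ℝ → E} (h : PrimOn Y Y') :
    ∀ᵐ s, s ∈ Ioo (0:ℝ) 1 → HasDerivAt Y (Y' s) s := by
  filter_upwards [(intInt_of_on h.1 (a := 0) (b := 1) (by simp) (by simp)).ae_hasDerivAt_integral]
    with s hs hs'
  have h1 := hs (by rw [uIcc_of_le zero_le_one]; exact Ioo_subset_Icc_self hs') 0 (by simp)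
  refine (h1.const_add (Y 0)).congr_of_eventuallyEq ?_
  filter_upwards [Ioo_mem_nhds hs'.1 hs'.2] with t ht
  exact h.2 t (Ioo_subset_Icc_self ht)

lemma ae_ne_pt (a : ℝ) : ∀ᵐ x : ℝ, x ≠ a := by simp [ae_iff, measure_singleton]

lemma primOn_of_ac {f f' : ℝ → E} (hf : AbsolutelyContinuousOnInterval f 0 1)
    (hi : IntegrableOn f' (Icc (0:ℝ) 1)) (hd : ∀ᵐ s, s ∈ Ioo (0:ℝ) 1 → HasDerivAt f (f' s) s) :
    PrimOn f f' := by
  refine ⟨hi, ?_⟩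
  have hP : PrimOn (fun t => ∫ s in (0:ℝ)..t, f' s) f' := ⟨hi, by intro t ht; simp⟩
  obtain ⟨C, hC⟩ := (hf.sub hP.ac).const_of_ae_hasDerivAt_zero (by
    filter_upwards [hd, hP.ae_deriv, ae_ne_pt 0, ae_ne_pt 1] with s h1 h2 h3 h4 h5
    rw [uIcc_of_le zero_le_one] at h5
    have h6 : s ∈ Ioo (0:ℝ) 1 := ⟨lt_of_le_of_ne h5.1 (Ne.symm h3), lt_of_le_of_ne h5.2 h4⟩
    simpa using (h1 h6).sub (h2 h6))
  intro t ht
  have e0 := hC 0 (by simp)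
  have e1 := hC t (by rwa [uIcc_of_le zero_le_one])
  simp only [Pi.sub_apply, intervalIntegral.integral_same, sub_zero] at e0 e1
  rw [e0, ← e1]; abel

lemma intOn_clm {Y' : ℝ → E} (h : IntegrableOn Y' (Icc (0:ℝ) 1)) {A : ℝ → E →L[ℝ] F}
    (hA : ContinuousOn A (Icc 0 1)) : IntegrableOn (fun s => A s (Y' s)) (Icc (0:ℝ) 1) := by
  obtain ⟨C, hC⟩ := isCompact_Icc.exists_bound_of_continuousOn hA
  refine Integrable.mono' (h.norm.const_mul C) ?_ ?_
  · exact (isBoundedBilinearMap_apply (𝕜 := ℝ) (E := E) (F := F)).continuous.comp_aestronglyMeasurable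
      ((hA.aestronglyMeasurable_of_isCompact isCompact_Icc measurableSet_Icc).prodMk h.1)
  · filter_upwards [ae_restrict_mem measurableSet_Icc] with s hs
    exact (A s).le_of_opNorm_le (hC s hs) _

lemma PrimOn.chain {Y Y' : ℝ → E} (h : PrimOn Y Y') {g : E → F} (hg : ContDiff ℝ 1 g) :
    PrimOn (fun s => g (Y s)) (fun s => fderiv ℝ g (Y s) (Y' s)) := by
  have hc : ContinuousOn (fun s => fderiv ℝ g (Y s)) (Icc 0 1) :=
    (hg.continuous_fderiv one_ne_zero).comp_continuousOn h.continuousOn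
  refine primOn_of_ac ?_ (intOn_clm h.1 hc) ?_
  · obtain ⟨K, hK⟩ := (hg.locallyLipschitz.locallyLipschitzOn
      (s := Y '' Icc 0 1)).exists_lipschitzOnWith_of_compact (isCompact_Icc.image_of_continuousOn h.continuousOn)
    have h1 := (show Tendsto _ _ _ from h.ac).const_mul (K:ℝ)
    rw [mul_zero] at h1
    refine squeeze_zero' ?_ ?_ h1
    · exact Eventually.of_forall fun E => Finset.sum_nonneg (fun _ _ => dist_nonneg)
    · filter_upwards [eventually_inf_principal.mpr (Eventually.of_forall fun E hE => hE)] with E hE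
      rw [Finset.mul_sum]
      refine Finset.sum_le_sum fun i hi => ?_
      have := hE.1 i hi
      rw [uIcc_of_le zero_le_one] at this
      exact hK.dist_le_mul _ (mem_image_of_mem _ this.1) _ (mem_image_of_mem _ this.2)
  · filter_upwards [h.ae_deriv] with s hs hs'
    exact ((hg.differentiable one_ne_zero) (Y s)).hasFDerivAt.comp_hasDerivAt s (hs hs')

lemma PrimOn.smul {φ φ' : ℝ → ℝ} {Y Y' : ℝ → E} (hφ : PrimOn φ φ') (h : PrimOn Y Y') :
    PrimOn (fun s => φ s • Y s) (fun s => φ' s • Y s + φ s • Y' s) := by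
  refine primOn_of_ac (hφ.ac.smul h.ac) ?_ ?_
  · refine Integrable.add ?_ ?_
    · exact IntegrableOn.smul_continuousOn hφ.1 h.continuousOn isCompact_Icc
    · exact IntegrableOn.continuousOn_smul h.1 hφ.continuousOn isCompact_Icc
  · filter_upwards [hφ.ae_deriv, h.ae_deriv] with s h1 h2 h3
    have := (h1 h3).smul (h2 h3)
    rw [add_comm]; exact this
end Prim


section Finsler
variable {n : ℕ} {G : Evec n → Evec n → ℝ} {ℓ α : ℝ}

lemma le_of_forall_scale {a b : ℝ} (h : ∀ t : ℝ, 0 < t → a ≤ b + ℓ * t) : a ≤ b := by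
  have h1 : Tendsto (fun t : ℝ => b + ℓ * t) (nhdsWithin 0 (Ioi 0)) (nhds (b + ℓ * 0)) :=
    Tendsto.mono_left (Continuous.tendsto (by fun_prop) 0) nhdsWithin_le_nhds
  rw [mul_zero, add_zero] at h1
  refine ge_of_tendsto h1 ?_
  filter_upwards [self_mem_nhdsWithin] with t ht
  exact h t ht

lemma dv_smul (hG : IsFinslerEnergy n G ℓ α) (q v : Evec n) {c : ℝ} (hc : 0 < c) :
    dvCLM G q (c • v) = c • dvCLM G q v := by
  have h1 : fderiv ℝ (fun u => G q (c • u)) v = c • dvCLM G q (c • v) :=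
    fderiv_comp_smul (f := fun w => G q w) c
  have h2 : (fun u => G q (c • u)) = fun u => c ^ 2 • G q u := by
    funext u; rw [hG.homog q u c hc, smul_eq_mul]
  rw [h2, show (fun u => c ^ 2 • G q u) = (c ^ 2) • (fun u => G q u) from rfl,
    fderiv_const_smul_field] at h1
  change c ^ 2 • dvCLM G q v = _ at h1
  have h3 : c • (c • dvCLM G q v) = c • dvCLM G q (c • v) := by rw [← h1, smul_smul, sq]
  exact (smul_right_injective _ hc.ne' h3).symm

lemma dq_smul (hG : IsFinslerEnergy n G ℓ α) (q v : Evec n) {c : ℝ} (hc : 0 < c) :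
    dqCLM G q (c • v) = c ^ 2 • dqCLM G q v := by
  have h2 : (fun u => G u (c • v)) = fun u => c ^ 2 • G u v := by
    funext u; rw [hG.homog u v c hc, smul_eq_mul]
  unfold dqCLM
  rw [h2, show (fun u => c ^ 2 • G u v) = (c ^ 2) • (fun u => G u v) from rfl,
    fderiv_const_smul_field]
  rfl

lemma dv_norm_le (hG : IsFinslerEnergy n G ℓ α) (q v : Evec n) : ‖dvCLM G q v‖ ≤ ℓ * ‖v‖ := by
  refine le_of_forall_scale (ℓ := ℓ) fun t ht => ?_
  have h := hG.dv_bound q (t⁻¹ • v)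
  rw [dv_smul hG q v (inv_pos.2 ht), norm_smul, norm_smul, Real.norm_of_nonneg (inv_pos.2 ht).le] at h
  have h2 := mul_le_mul_of_nonneg_left h ht.le
  have h3 : t * (t⁻¹ * ‖dvCLM G q v‖) = ‖dvCLM G q v‖ := by field_simp
  have h4 : t * (ℓ * (1 + t⁻¹ * ‖v‖)) = ℓ * ‖v‖ + ℓ * t := by field_simp; ring
  rwa [h3, h4] at h2

lemma dq_norm_le (hG : IsFinslerEnergy n G ℓ α) (q v : Evec n) : ‖dqCLM G q v‖ ≤ ℓ * ‖v‖ ^ 2 := by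
  refine le_of_forall_scale (ℓ := ℓ) fun t ht => ?_
  have hs : 0 < √t := Real.sqrt_pos.2 ht
  have h := hG.dq_bound q ((√t)⁻¹ • v)
  rw [dq_smul hG q v (inv_pos.2 hs), norm_smul, norm_smul, mul_pow, norm_pow,
    Real.norm_of_nonneg (inv_pos.2 hs).le, inv_pow, Real.sq_sqrt ht.le] at h
  have h2 := mul_le_mul_of_nonneg_left h ht.le
  have h3 : t * (t⁻¹ * ‖dqCLM G q v‖) = ‖dqCLM G q v‖ := by field_simp
  have h4 : t * (ℓ * (1 + t⁻¹ * ‖v‖ ^ 2)) = ℓ * ‖v‖ ^ 2 + ℓ * t := by field_simp; ring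
  rwa [h3, h4] at h2

lemma isOpen_snd_ne : IsOpen {p : Evec n × Evec n | p.2 ≠ 0} :=
  isOpen_ne_fun continuous_snd continuous_const

lemma G_cda (hG : IsFinslerEnergy n G ℓ α) {p : Evec n × Evec n} (hp : p.2 ≠ 0) :
    ContDiffAt ℝ 2 (fun p : Evec n × Evec n => G p.1 p.2) p :=
  hG.smooth.contDiffAt (isOpen_snd_ne.mem_nhds hp)

lemma dv_eq (hG : IsFinslerEnergy n G ℓ α) {p : Evec n × Evec n} (hp : p.2 ≠ 0) :
    dvCLM G p.1 p.2 = (fderiv ℝ (fun p : Evec n × Evec n => G p.1 p.2) p).comp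
      (ContinuousLinearMap.inr ℝ _ _) := by
  have h := ((G_cda hG hp).differentiableAt two_ne_zero).hasFDerivAt
  exact (HasFDerivAt.comp (f := fun u => (p.1, u)) p.2 h (hasFDerivAt_prodMk_right p.1 p.2)).fderiv

lemma dq_eq (hG : IsFinslerEnergy n G ℓ α) {p : Evec n × Evec n} (hp : p.2 ≠ 0) :
    dqCLM G p.1 p.2 = (fderiv ℝ (fun p : Evec n × Evec n => G p.1 p.2) p).comp
      (ContinuousLinearMap.inl ℝ _ _) := by
  have h := ((G_cda hG hp).differentiableAt two_ne_zero).hasFDerivAt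
  exact (HasFDerivAt.comp (f := fun u => (u, p.2)) p.1 h (hasFDerivAt_prodMk_left p.1 p.2)).fderiv

lemma dv_cont (hG : IsFinslerEnergy n G ℓ α) :
    Continuous fun p : Evec n × Evec n => dvCLM G p.1 p.2 := by
  rw [continuous_iff_continuousAt]
  intro p
  by_cases hp : p.2 = 0
  · have h0 : dvCLM G p.1 p.2 = 0 := by
      have := dv_norm_le hG p.1 p.2
      rw [hp, norm_zero, mul_zero] at this
      rw [hp]; exact norm_le_zero_iff.1 this
    unfold ContinuousAt
    beta_reduce
    rw [h0]
    refine squeeze_zero_norm (fun p => dv_norm_le hG p.1 p.2) ?_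
    have : Continuous fun p : Evec n × Evec n => ℓ * ‖p.2‖ := by fun_prop
    simpa [hp] using this.tendsto p
  · have h1 : ContinuousAt (fderiv ℝ (fun p : Evec n × Evec n => G p.1 p.2)) p :=
      ((G_cda hG hp).fderiv_right (m := 1) (by norm_num)).continuousAt
    refine ContinuousAt.congr (f := fun p => (fderiv ℝ (fun p : Evec n × Evec n => G p.1 p.2) p).comp
      (ContinuousLinearMap.inr ℝ _ _)) (h1.clm_comp continuousAt_const) ?_
    filter_upwards [isOpen_snd_ne.mem_nhds hp] with r hr
    exact (dv_eq hG hr).symm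

lemma dq_cont (hG : IsFinslerEnergy n G ℓ α) :
    Continuous fun p : Evec n × Evec n => dqCLM G p.1 p.2 := by
  rw [continuous_iff_continuousAt]
  intro p
  by_cases hp : p.2 = 0
  · have h0 : dqCLM G p.1 p.2 = 0 := by
      have := dq_norm_le hG p.1 p.2
      rw [hp, norm_zero] at this
      rw [hp]; exact norm_le_zero_iff.1 (by simpa using this)
    unfold ContinuousAt
    beta_reduce
    rw [h0]
    refine squeeze_zero_norm (fun p => dq_norm_le hG p.1 p.2) ?_
    have : Continuous fun p : Evec n × Evec n => ℓ * ‖p.2‖ ^ 2 := by fun_prop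
    simpa [hp] using this.tendsto p
  · have h1 : ContinuousAt (fderiv ℝ (fun p : Evec n × Evec n => G p.1 p.2)) p :=
      ((G_cda hG hp).fderiv_right (m := 1) (by norm_num)).continuousAt
    refine ContinuousAt.congr (f := fun p => (fderiv ℝ (fun p : Evec n × Evec n => G p.1 p.2) p).comp
      (ContinuousLinearMap.inl ℝ _ _)) (h1.clm_comp continuousAt_const) ?_
    filter_upwards [isOpen_snd_ne.mem_nhds hp] with r hr
    exact (dq_eq hG hr).symm

lemma dv_diff (hG : IsFinslerEnergy n G ℓ α) (q : Evec n) {v : Evec n} (hv : v ≠ 0) :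
    DifferentiableAt ℝ (fun u => dvCLM G q u) v := by
  have h : ContDiffAt ℝ 2 (fun u => G q u) v :=
    (G_cda hG (p := (q, v)) hv).comp v (by fun_prop)
  exact (h.fderiv_right (m := 1) (by norm_num)).differentiableAt one_ne_zero

lemma dv_mono (hG : IsFinslerEnergy n G ℓ α) (q v₁ v₂ : Evec n) :
    α * ‖v₁ - v₂‖ ^ 2 ≤ (dvCLM G q v₁ - dvCLM G q v₂) (v₁ - v₂) := by
  set w := v₁ - v₂ with hw
  by_cases hw0 : w = 0
  · simp [hw0]
  let γ : ℝ → Evec n := fun t => v₂ + t • w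
  let f : ℝ → ℝ := fun t => dvCLM G q (γ t) w - α * ‖w‖ ^ 2 * t
  have hγ : Continuous γ := by fun_prop
  have hf : Continuous f := by
    have h1 : Continuous fun t => dvCLM G q (γ t) := (dv_cont hG).comp (by fun_prop : Continuous fun t => (q, γ t))
    exact (h1.clm_apply continuous_const).sub (by fun_prop)
  obtain ⟨t₀, ht₀⟩ : ∃ t₀, ∀ t, t ≠ t₀ → γ t ≠ 0 := by
    by_cases h : ∃ t₀, γ t₀ = 0
    · obtain ⟨t₀, h0⟩ := h
      refine ⟨t₀, fun t ht h1 => ht ?_⟩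
      have : (t - t₀) • w = 0 := by
        have : γ t - γ t₀ = (t - t₀) • w := by simp only [γ]; module
        rw [← this, h0, h1, sub_zero]
      rcases smul_eq_zero.1 this with h | h
      · linarith
      · exact absurd h hw0
    · push Not at h
      exact ⟨0, fun t _ => h t⟩
  have hd : ∀ t, t ≠ t₀ → ∃ d, 0 ≤ d ∧ HasDerivAt f d t := by
    intro t ht
    have h1 : DifferentiableAt ℝ (fun u => dvCLM G q u w) (γ t) :=
      (dv_diff hG q (ht₀ t ht)).clm_apply (differentiableAt_const _)
    have h2 : HasDerivAt γ w t := by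
      have := ((hasDerivAt_id t).smul_const w).const_add v₂
      rwa [one_smul] at this
    have h3 := h1.hasFDerivAt.comp_hasDerivAt t h2
    refine ⟨_, ?_, h3.sub ((hasDerivAt_id t).const_mul (α * ‖w‖ ^ 2))⟩
    have := hG.vv_convex q (γ t) (ht₀ t ht) w
    simpa using this
  have hm : Monotone f := by
    have h1 : MonotoneOn f (Iic t₀) := by
      refine monotoneOn_of_deriv_nonneg (convex_Iic _) hf.continuousOn ?_ ?_
      · intro t ht
        rw [interior_Iic] at ht
        obtain ⟨d, _, h⟩ := hd t (ne_of_lt ht)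
        exact h.differentiableAt.differentiableWithinAt
      · intro t ht
        rw [interior_Iic] at ht
        obtain ⟨d, h0, h⟩ := hd t (ne_of_lt ht)
        rw [h.deriv]; exact h0
    have h2 : MonotoneOn f (Ici t₀) := by
      refine monotoneOn_of_deriv_nonneg (convex_Ici _) hf.continuousOn ?_ ?_
      · intro t ht
        rw [interior_Ici] at ht
        obtain ⟨d, _, h⟩ := hd t (ne_of_gt ht)
        exact h.differentiableAt.differentiableWithinAt
      · intro t ht
        rw [interior_Ici] at ht
        obtain ⟨d, h0, h⟩ := hd t (ne_of_gt ht)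
        rw [h.deriv]; exact h0
    exact h1.Iic_union_Ici h2
  have := hm zero_le_one
  simp only [f, γ, zero_smul, one_smul, add_zero, hw, add_sub_cancel] at this
  rw [← hw] at this
  rw [_root_.sub_apply]
  linarith

lemma dv_self (hG : IsFinslerEnergy n G ℓ α) (q v : Evec n) : α * ‖v‖ ^ 2 ≤ dvCLM G q v v := by
  have h0 : dvCLM G q 0 = 0 := by
    have := dv_norm_le hG q 0
    rw [norm_zero, mul_zero] at this
    exact norm_le_zero_iff.1 this
  have := dv_mono hG q v 0
  simpa [h0] using this
end Finsler


section Test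
variable {n : ℕ} {G : Evec n → Evec n → ℝ} {ℓ α : ℝ}

/-- The momentum along `x` paired with `η(x)`. -/
def hfun (G : Evec n → Evec n → ℝ) (x : H1Curve n 0 1) (η : Evec n → Evec n) (s : ℝ) : ℝ :=
  dvCLM G (x.toFun s) (x.deriv s) (η (x.toFun s))

/-- The zeroth order term of the first variation. -/
def ffun (G : Evec n → Evec n → ℝ) (x : H1Curve n 0 1) (η : Evec n → Evec n) (s : ℝ) : ℝ :=
  dqCLM G (x.toFun s) (x.deriv s) (η (x.toFun s)) +
    dvCLM G (x.toFun s) (x.deriv s) (fderiv ℝ η (x.toFun s) (x.deriv s))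

/-- The difference of the momentum and the primitive of the zeroth order term. -/
def kfun (G : Evec n → Evec n → ℝ) (x : H1Curve n 0 1) (η : Evec n → Evec n) (s : ℝ) : ℝ :=
  hfun G x η s - ∫ r in (0:ℝ)..s, ffun G x η r

lemma x_prim (x : H1Curve n 0 1) : PrimOn x.toFun x.deriv := ⟨x.deriv_integrable, x.eq_add_integral⟩

lemma x_meas (x : H1Curve n 0 1) :
    AEStronglyMeasurable x.toFun (volume.restrict (Icc (0:ℝ) 1)) :=
  (x_prim x).continuousOn.aestronglyMeasurable_of_isCompact isCompact_Icc measurableSet_Icc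

lemma comp_bound (x : H1Curve n 0 1) {H : Type*} [NormedAddCommGroup H] {g : Evec n → H}
    (hg : Continuous g) : ∃ C, 0 ≤ C ∧ ∀ s ∈ Icc (0:ℝ) 1, ‖g (x.toFun s)‖ ≤ C := by
  obtain ⟨C, hC⟩ := isCompact_Icc.exists_bound_of_continuousOn (hg.comp_continuousOn (x_prim x).continuousOn)
  exact ⟨|C|, abs_nonneg _, fun s hs => (hC s hs).trans (le_abs_self _)⟩

lemma clm_apply_aesm {H K : Type*} [NormedAddCommGroup H] [NormedSpace ℝ H]
    [NormedAddCommGroup K] [NormedSpace ℝ K] {μ : Measure ℝ}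
    {A : ℝ → H →L[ℝ] K} {u : ℝ → H} (hA : AEStronglyMeasurable A μ) (hu : AEStronglyMeasurable u μ) :
    AEStronglyMeasurable (fun s => A s (u s)) μ :=
  (isBoundedBilinearMap_apply (𝕜 := ℝ) (E := H) (F := K)).continuous.comp_aestronglyMeasurable
      (hA.prodMk hu)

lemma dv_meas (hG : IsFinslerEnergy n G ℓ α) (x : H1Curve n 0 1) :
    AEStronglyMeasurable (fun s => dvCLM G (x.toFun s) (x.deriv s)) (volume.restrict (Icc (0:ℝ) 1)) :=
  (dv_cont hG).comp_aestronglyMeasurable ((x_meas x).prodMk x.deriv_integrable.1)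

lemma dq_meas (hG : IsFinslerEnergy n G ℓ α) (x : H1Curve n 0 1) :
    AEStronglyMeasurable (fun s => dqCLM G (x.toFun s) (x.deriv s)) (volume.restrict (Icc (0:ℝ) 1)) :=
  (dq_cont hG).comp_aestronglyMeasurable ((x_meas x).prodMk x.deriv_integrable.1)

lemma h_int (hG : IsFinslerEnergy n G ℓ α) (x : H1Curve n 0 1) {η : Evec n → Evec n}
    (hη : ContDiff ℝ 1 η) : IntegrableOn (hfun G x η) (Icc (0:ℝ) 1) := by
  obtain ⟨C, hC0, hC⟩ := comp_bound x hη.continuous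
  refine Integrable.mono' (x.deriv_integrable.norm.const_mul (ℓ * C)) ?_ ?_
  · exact clm_apply_aesm (dv_meas hG x) (hη.continuous.comp_aestronglyMeasurable (x_meas x))
  · filter_upwards [ae_restrict_mem measurableSet_Icc] with s hs
    calc ‖hfun G x η s‖ ≤ ‖dvCLM G (x.toFun s) (x.deriv s)‖ * ‖η (x.toFun s)‖ :=
          ContinuousLinearMap.le_opNorm _ _
      _ ≤ (ℓ * ‖x.deriv s‖) * C := by
          gcongr
          · have := hG.one_le_ell
            positivity
          · exact dv_norm_le hG _ _
          · exact hC s hs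
      _ = _ := by ring

lemma f_int (hG : IsFinslerEnergy n G ℓ α) (x : H1Curve n 0 1) {η : Evec n → Evec n}
    (hη : ContDiff ℝ 1 η) : IntegrableOn (ffun G x η) (Icc (0:ℝ) 1) := by
  obtain ⟨C, hC0, hC⟩ := comp_bound x hη.continuous
  have hη' : Continuous (fderiv ℝ η) := hη.continuous_fderiv one_ne_zero
  obtain ⟨D, hD0, hD⟩ := comp_bound x hη'
  have hl := hG.one_le_ell
  refine Integrable.mono' (x.deriv_sq_integrable.const_mul (ℓ * C + ℓ * D)) ?_ ?_
  · exact (clm_apply_aesm (dq_meas hG x) (hη.continuous.comp_aestronglyMeasurable (x_meas x))).add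
      (clm_apply_aesm (dv_meas hG x)
        (clm_apply_aesm (hη'.comp_aestronglyMeasurable (x_meas x)) x.deriv_integrable.1))
  · filter_upwards [ae_restrict_mem measurableSet_Icc] with s hs
    have h1 : ‖dqCLM G (x.toFun s) (x.deriv s) (η (x.toFun s))‖ ≤ (ℓ * ‖x.deriv s‖ ^ 2) * C := by
      refine (ContinuousLinearMap.le_opNorm _ _).trans ?_
      gcongr
      · exact dq_norm_le hG _ _
      · exact hC s hs
    have h2 : ‖dvCLM G (x.toFun s) (x.deriv s) (fderiv ℝ η (x.toFun s) (x.deriv s))‖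
        ≤ (ℓ * ‖x.deriv s‖) * (D * ‖x.deriv s‖) := by
      refine (ContinuousLinearMap.le_opNorm _ _).trans ?_
      gcongr
      · exact dv_norm_le hG _ _
      · exact ContinuousLinearMap.le_of_opNorm_le _ (hD s hs) _
    refine (norm_add_le _ _).trans ((add_le_add h1 h2).trans (le_of_eq (by ring)))

lemma F_prim (hG : IsFinslerEnergy n G ℓ α) (x : H1Curve n 0 1) {η : Evec n → Evec n}
    (hη : ContDiff ℝ 1 η) : PrimOn (fun t => ∫ r in (0:ℝ)..t, ffun G x η r) (ffun G x η) :=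
  ⟨f_int hG x hη, by intro t _; simp⟩

lemma k_int (hG : IsFinslerEnergy n G ℓ α) (x : H1Curve n 0 1) {η : Evec n → Evec n}
    (hη : ContDiff ℝ 1 η) : IntegrableOn (kfun G x η) (Icc (0:ℝ) 1) :=
  (h_int hG x hη).sub ((F_prim hG x hη).continuousOn.integrableOn_Icc)

lemma test_curve (hG : IsFinslerEnergy n G ℓ α) (x : H1Curve n 0 1) {η : Evec n → Evec n}
    (hη : ContDiff ℝ 1 η) {φ ψ : ℝ → ℝ} {C : ℝ} (hφ : PrimOn φ ψ) (hψ : ∀ s, |ψ s| ≤ C)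
    (hφ1 : φ 1 = 0) :
    ∃ ξ : H1Curve n 0 1, (∀ s, ξ.toFun s = φ s • η (x.toFun s)) ∧
      dJ G x ξ = (1 / 2) * ∫ s in (0:ℝ)..1, ψ s * kfun G x η s := by
  have hP := hφ.smul ((x_prim x).chain hη)
  have hη' : Continuous (fderiv ℝ η) := hη.continuous_fderiv one_ne_zero
  obtain ⟨A, hA0, hA⟩ := comp_bound x hη.continuous
  obtain ⟨D, hD0, hD⟩ := comp_bound x hη'
  obtain ⟨B, hB⟩ := isCompact_Icc.exists_bound_of_continuousOn hφ.continuousOn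
  have hC0 : 0 ≤ C := (abs_nonneg _).trans (hψ 0)
  have hB0 : 0 ≤ B := (norm_nonneg _).trans (hB 0 (by simp))
  refine ⟨⟨_, _, hP.1, ?_, hP.2⟩, fun s => rfl, ?_⟩
  · refine Integrable.mono' (g := fun s => 2 * (C * A) ^ 2 + 2 * (B * D) ^ 2 * ‖x.deriv s‖ ^ 2) ?_ ?_ ?_
    · exact (integrable_const _).add (x.deriv_sq_integrable.const_mul _)
    · exact hP.1.1.norm.pow 2
    · filter_upwards [ae_restrict_mem measurableSet_Icc] with s hs
      rw [norm_pow, norm_norm]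
      have h1 : ‖ψ s • η (x.toFun s)‖ ≤ C * A := by
        rw [norm_smul]
        exact mul_le_mul (hψ s) (hA s hs) (norm_nonneg _) hC0
      have h2 : ‖φ s • fderiv ℝ η (x.toFun s) (x.deriv s)‖ ≤ B * (D * ‖x.deriv s‖) := by
        rw [norm_smul]
        exact mul_le_mul (hB s hs) (ContinuousLinearMap.le_of_opNorm_le _ (hD s hs) _) (norm_nonneg _) hB0
      have h3 := (norm_add_le _ _).trans (add_le_add h1 h2)
      have h4 := pow_le_pow_left₀ (norm_nonneg _) h3 2
      refine h4.trans ?_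
      nlinarith [sq_nonneg (C * A - B * (D * ‖x.deriv s‖))]
  · have hF := hφ.smul (F_prim hG x hη)
    have h1 := hF.2 1 (by simp)
    simp only [hφ1, zero_smul, intervalIntegral.integral_same, smul_zero, zero_add] at h1
    have i0 : (0:ℝ) ∈ Icc (0:ℝ) 1 := by simp
    have i1 : (1:ℝ) ∈ Icc (0:ℝ) 1 := by simp
    have hψm : AEStronglyMeasurable ψ (volume.restrict (Icc (0:ℝ) 1)) := hφ.1.1
    have hψk : IntegrableOn (fun s => ψ s * kfun G x η s) (Icc (0:ℝ) 1) :=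
      (k_int hG x hη).bdd_mul hψm (Eventually.of_forall hψ)
    have h2 : ∀ s, dqCLM G (x.toFun s) (x.deriv s) (φ s • η (x.toFun s)) +
        dvCLM G (x.toFun s) (x.deriv s) (ψ s • η (x.toFun s) + φ s • fderiv ℝ η (x.toFun s) (x.deriv s))
        = ψ s * kfun G x η s + (ψ s • (∫ r in (0:ℝ)..s, ffun G x η r) + φ s • ffun G x η s) := by
      intro s
      simp only [map_add, map_smul, smul_eq_mul, kfun, hfun, ffun]
      ring
    unfold dJ
    simp only [h2]
    rw [intervalIntegral.integral_add (intInt_of_on hψk i0 i1) (intInt_of_on hF.1 i0 i1), ← h1, add_zero]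
end Test


section Grad
variable {n : ℕ} {G : Evec n → Evec n → ℝ} {ℓ α : ℝ} {Φ : Evec n → ℝ} {δ₀ : ℝ}

lemma grad_cd (hΦ : IsRegularDomain n Φ δ₀) : ContDiff ℝ 1 (gradient Φ) := by
  have h : ContDiff ℝ 1 (fderiv ℝ Φ) := hΦ.smooth.fderiv_right (by norm_num)
  exact (InnerProductSpace.toDual ℝ (Evec n)).symm.contDiff.comp h

/-- The (unnormalized) projection of `w` to the tangent space of the level sets of `Φ`. -/
def Tf (Φ : Evec n → ℝ) (w q : Evec n) : Evec n :=
  ‖gradient Φ q‖ ^ 2 • w - ⟪gradient Φ q, w⟫ • gradient Φ q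

lemma Tf_cd (hΦ : IsRegularDomain n Φ δ₀) (w : Evec n) : ContDiff ℝ 1 (Tf Φ w) := by
  have h := grad_cd hΦ
  unfold Tf
  exact ((h.norm_sq ℝ).smul contDiff_const).sub ((h.inner ℝ contDiff_const).smul h)

lemma Tf_orth (w q : Evec n) : ⟪gradient Φ q, Tf Φ w q⟫ = 0 := by
  unfold Tf
  rw [inner_sub_right, inner_smul_right, inner_smul_right, real_inner_self_eq_norm_sq]
  ring

lemma PrimOn.sub {E : Type*} [NormedAddCommGroup E] [NormedSpace ℝ E] [CompleteSpace E]
    {Y Y' Z Z' : ℝ → E} (h : PrimOn Y Y') (h2 : PrimOn Z Z') :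
    PrimOn (fun s => Y s - Z s) (fun s => Y' s - Z' s) := by
  refine ⟨h.1.sub h2.1, fun t ht => ?_⟩
  have i0 : (0:ℝ) ∈ Icc (0:ℝ) 1 := by simp
  beta_reduce
  rw [intervalIntegral.integral_sub (intInt_of_on h.1 i0 ht) (intInt_of_on h2.1 i0 ht), h.2 t ht,
    h2.2 t ht]
  abel

lemma PrimOn.neg {E : Type*} [NormedAddCommGroup E] [NormedSpace ℝ E] [CompleteSpace E]
    {Y Y' : ℝ → E} (h : PrimOn Y Y') : PrimOn (fun s => - Y s) (fun s => - Y' s) := by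
  refine ⟨h.1.neg, fun t ht => ?_⟩
  beta_reduce
  rw [intervalIntegral.integral_neg, h.2 t ht]
  abel

lemma T_zero (hG : IsFinslerEnergy n G ℓ α) (hΦ : IsRegularDomain n Φ δ₀)
    {x : H1Curve n 0 1} (hx : IsVCritical G Φ x) (w : Evec n) :
    kfun G x (Tf Φ w) =ᵐ[volume.restrict (Icc (0:ℝ) 1)] 0 := by
  refine Integrable.ae_eq_zero_of_forall_setIntegral_eq_zero (k_int hG x (Tf_cd hΦ w)) ?_
  intro A hA _
  let ψ : ℝ → ℝ := A.indicator (fun _ => 1)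
  have hψ : IntegrableOn ψ (Icc (0:ℝ) 1) := (integrable_const (1:ℝ)).indicator hA
  let φ : ℝ → ℝ := fun t => (∫ s in (0:ℝ)..t, ψ s) - ∫ s in (0:ℝ)..1, ψ s
  have hφ : PrimOn φ ψ := ⟨hψ, fun t _ => by simp [φ]; ring⟩
  have hφ1 : φ 1 = 0 := by simp [φ]
  have hb : ∀ s, |ψ s| ≤ 1 := by
    intro s
    by_cases h : s ∈ A <;> simp [ψ, h]
  obtain ⟨ξ, h1, h2⟩ := test_curve hG x (Tf_cd hΦ w) hφ hb hφ1
  obtain ⟨ξ', h1', h2'⟩ := test_curve hG x (Tf_cd hΦ w) hφ.neg (C := 1) (by simpa using hb) (by simp [hφ1])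
  have o1 := hx.2 ξ ⟨by rw [h1, inner_smul_right, Tf_orth, mul_zero],
    by rw [h1, inner_smul_right, Tf_orth, mul_zero],
    fun s _ _ => by rw [h1, inner_smul_right, Tf_orth, mul_zero]⟩
  have o2 := hx.2 ξ' ⟨by rw [h1', inner_smul_right, Tf_orth, mul_zero],
    by rw [h1', inner_smul_right, Tf_orth, mul_zero],
    fun s _ _ => by rw [h1', inner_smul_right, Tf_orth, mul_zero]⟩
  rw [h2] at o1
  rw [h2'] at o2
  simp only [neg_mul, intervalIntegral.integral_neg] at o2
  have h3 : ∫ s in (0:ℝ)..1, ψ s * kfun G x (Tf Φ w) s = 0 := by linarith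
  rw [intervalIntegral.integral_of_le zero_le_one, ← integral_Icc_eq_integral_Ioc] at h3
  rw [← integral_indicator hA]
  refine Eq.trans ?_ h3
  congr 1
  funext s
  by_cases h : s ∈ A <;> simp [ψ, h]

/-- A ramp from `0` to `1` on `[a, a+ε]`. -/
def ramp (a ε t : ℝ) : ℝ := ε⁻¹ * max 0 (min (t - a) ε)

/-- The derivative of the ramp. -/
def ramp' (a ε : ℝ) : ℝ → ℝ := (Ioc a (a + ε)).indicator (fun _ => ε⁻¹)

lemma ramp_prim {a ε : ℝ} (ha : 0 < a) (_hε : 0 < ε) : PrimOn (ramp a ε) (ramp' a ε) := by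
  refine ⟨(integrable_const (ε⁻¹)).indicator measurableSet_Ioc, fun t ht => ?_⟩
  have h0 : ramp a ε 0 = 0 := by
    unfold ramp
    rw [max_eq_left (min_le_of_left_le (by linarith)), mul_zero]
  rw [h0, zero_add, intervalIntegral.integral_of_le ht.1]
  unfold ramp'
  rw [setIntegral_indicator measurableSet_Ioc, Ioc_inter_Ioc, setIntegral_const, Real.volume_real_Ioc,
    smul_eq_mul, mul_comm, max_eq_right ha.le, max_comm]
  unfold ramp
  congr 2
  rw [← min_sub_sub_right, add_sub_cancel_left]

lemma ramp_bd {a ε : ℝ} (hε : 0 < ε) (s : ℝ) : |ramp' a ε s| ≤ ε⁻¹ := by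
  unfold ramp'
  by_cases h : s ∈ Ioc a (a + ε)
  · rw [indicator_of_mem h, abs_of_pos (inv_pos.2 hε)]
  · rw [indicator_of_notMem h, abs_zero]; exact (inv_pos.2 hε).le

lemma ramp_low {a ε t : ℝ} (ht : t ≤ a) : ramp a ε t = 0 := by
  unfold ramp
  rw [max_eq_left (min_le_of_left_le (by linarith)), mul_zero]

lemma ramp_high {a ε t : ℝ} (hε : 0 < ε) (ht : a + ε ≤ t) : ramp a ε t = 1 := by
  unfold ramp
  rw [min_eq_right (by linarith), max_eq_right hε.le, inv_mul_cancel₀ hε.ne']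

lemma ramp_anti {a b ε t : ℝ} (hε : 0 < ε) (hab : a ≤ b) : ramp b ε t ≤ ramp a ε t := by
  unfold ramp
  gcongr

lemma ramp_integral {k : ℝ → ℝ} {a ε : ℝ} (ha : 0 < a) (hε : 0 < ε) (h1 : a + ε < 1) :
    ∫ s in (0:ℝ)..1, ramp' a ε s * k s = ε⁻¹ * ∫ s in a..(a + ε), k s := by
  have : (fun s => ramp' a ε s * k s) = (Ioc a (a + ε)).indicator (fun s => ε⁻¹ * k s) := by
    funext s
    unfold ramp'
    by_cases h : s ∈ Ioc a (a + ε) <;> simp [h]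
  rw [this, intervalIntegral.integral_of_le zero_le_one, setIntegral_indicator measurableSet_Ioc,
    Ioc_inter_Ioc, max_eq_right ha.le, min_eq_right h1.le, integral_const_mul,
    intervalIntegral.integral_of_le (by linarith)]

lemma ramp_mul_int {k : ℝ → ℝ} (hk : IntegrableOn k (Icc (0:ℝ) 1)) {a ε : ℝ} (hε : 0 < ε) :
    IntegrableOn (fun s => ramp' a ε s * k s) (Icc (0:ℝ) 1) :=
  hk.bdd_mul (((measurable_const.indicator measurableSet_Ioc).aestronglyMeasurable))
    (Eventually.of_forall (ramp_bd hε))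

lemma step_aux (hG : IsFinslerEnergy n G ℓ α) (hΦ : IsRegularDomain n Φ δ₀)
    {x : H1Curve n 0 1} {a b ε : ℝ} (ha : 0 < a) (hab : a < b) (hε : 0 < ε)
    (hb : b + ε < 1) :
    ∃ ξ ξ' : H1Curve n 0 1, (∀ s, ξ.toFun s = -(ramp a ε s - ramp b ε s) • gradient Φ (x.toFun s)) ∧
      (∀ s, ξ'.toFun s = (ramp a ε s - ramp b ε s) • gradient Φ (x.toFun s)) ∧
      dJ G x ξ = (1 / 2) * (ε⁻¹ * ((∫ s in b..(b + ε), kfun G x (gradient Φ) s) -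
        ∫ s in a..(a + ε), kfun G x (gradient Φ) s)) ∧
      dJ G x ξ' = - ((1 / 2) * (ε⁻¹ * ((∫ s in b..(b + ε), kfun G x (gradient Φ) s) -
        ∫ s in a..(a + ε), kfun G x (gradient Φ) s))) := by
  have hb0 : 0 < b := ha.trans hab
  have hP := (ramp_prim ha hε).sub (ramp_prim hb0 hε)
  have h1 : ramp a ε 1 - ramp b ε 1 = 0 := by
    rw [ramp_high hε (by linarith), ramp_high hε hb.le, sub_self]
  have hbd : ∀ s, |ramp' a ε s - ramp' b ε s| ≤ 2 * ε⁻¹ := by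
    intro s
    have h1 := abs_le.1 (ramp_bd (a := a) hε s)
    have h2 := abs_le.1 (ramp_bd (a := b) hε s)
    rw [abs_le]; constructor <;> linarith
  obtain ⟨ξ', e1, e2⟩ := test_curve hG x (grad_cd hΦ) hP hbd h1
  obtain ⟨ξ, e3, e4⟩ := test_curve hG x (grad_cd hΦ) hP.neg (C := 2 * ε⁻¹)
    (by intro s; rw [abs_neg]; exact hbd s) (by simp [h1])
  have hk := k_int hG x (grad_cd hΦ)
  have i0 : (0:ℝ) ∈ Icc (0:ℝ) 1 := by simp
  have i1 : (1:ℝ) ∈ Icc (0:ℝ) 1 := by simp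
  have key : ∫ s in (0:ℝ)..1, (ramp' a ε s - ramp' b ε s) * kfun G x (gradient Φ) s =
      ε⁻¹ * (∫ s in a..(a + ε), kfun G x (gradient Φ) s) -
        ε⁻¹ * ∫ s in b..(b + ε), kfun G x (gradient Φ) s := by
    simp only [sub_mul]
    rw [intervalIntegral.integral_sub (intInt_of_on (ramp_mul_int hk hε) i0 i1)
      (intInt_of_on (ramp_mul_int hk hε) i0 i1), ramp_integral ha hε (by linarith),
      ramp_integral hb0 hε hb]
  refine ⟨ξ, ξ', e3, e1, ?_, ?_⟩
  · rw [e4]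
    simp only [neg_mul, intervalIntegral.integral_neg]
    rw [key]; ring
  · rw [e2, key]; ring

lemma step_le (hG : IsFinslerEnergy n G ℓ α) (hΦ : IsRegularDomain n Φ δ₀)
    {x : H1Curve n 0 1} (hx : IsVCritical G Φ x) {a b ε : ℝ} (ha : 0 < a) (hab : a < b) (hε : 0 < ε)
    (hb : b + ε < 1) :
    ε⁻¹ * (∫ s in a..(a + ε), kfun G x (gradient Φ) s) ≤
      ε⁻¹ * ∫ s in b..(b + ε), kfun G x (gradient Φ) s := by
  obtain ⟨ξ, ξ', e1, -, e2, -⟩ := step_aux (x := x) hG hΦ ha hab hε hb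
  have := hx.2 ξ ⟨by rw [e1, ramp_low ha.le, ramp_low (ha.trans hab).le]; simp,
    by rw [e1, ramp_high hε (by linarith), ramp_high hε hb.le]; simp,
    fun s _ _ => by
      rw [e1, inner_smul_right, real_inner_self_eq_norm_sq]
      have := ramp_anti (t := s) hε hab.le
      nlinarith [sq_nonneg ‖gradient Φ (x.toFun s)‖]⟩
  rw [e2] at this
  linarith

lemma step_ge (hG : IsFinslerEnergy n G ℓ α) (hΦ : IsRegularDomain n Φ δ₀)
    {x : H1Curve n 0 1} (hx : IsVCritical G Φ x) {a b ε s₀ : ℝ} (ha : 0 < a) (hab : a < b)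
    (hε : 0 < ε) (hb : b + ε < s₀) (hs₀ : s₀ ≤ 1)
    (hc : ∀ s ∈ Ioo 0 s₀, Φ (x.toFun s) < 0) :
    ε⁻¹ * (∫ s in b..(b + ε), kfun G x (gradient Φ) s) ≤
      ε⁻¹ * ∫ s in a..(a + ε), kfun G x (gradient Φ) s := by
  obtain ⟨ξ, ξ', -, e1, -, e2⟩ := step_aux (x := x) hG hΦ ha hab hε (hb.trans_le hs₀)
  have := hx.2 ξ' ⟨by rw [e1, ramp_low ha.le, ramp_low (ha.trans hab).le]; simp,
    by rw [e1, ramp_high hε (by linarith), ramp_high hε (by linarith)]; simp,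
    fun s h1 h2 => by
      have h3 : s₀ ≤ s := by
        by_contra h
        exact (hc s ⟨h1.1, not_le.1 h⟩).ne h2
      rw [e1, ramp_high hε (by linarith), ramp_high hε (by linarith)]; simp⟩
  rw [e2] at this
  linarith

/-- Lebesgue points of `k`. -/
def LebPt (k : ℝ → ℝ) (s : ℝ) : Prop :=
  s ∈ Ioo (0:ℝ) 1 ∧ Tendsto (fun ε => ε⁻¹ * ∫ r in s..(s + ε), k r) (nhdsWithin 0 (Ioi 0)) (nhds (k s))

lemma ae_leb {k : ℝ → ℝ} (hk : IntegrableOn k (Icc (0:ℝ) 1)) :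
    ∀ᵐ s, s ∈ Ioo (0:ℝ) 1 → LebPt k s := by
  have hP : PrimOn (fun t => ∫ r in (0:ℝ)..t, k r) k := ⟨hk, by intro t _; simp⟩
  filter_upwards [hP.ae_deriv] with s h1 hs
  refine ⟨hs, ?_⟩
  have h2 := hasDerivAt_iff_tendsto_slope_zero.1 (h1 hs)
  have h3 := h2.mono_left (nhdsWithin_mono 0 (fun t (ht : t ∈ Ioi (0:ℝ)) => ne_of_gt ht))
  refine h3.congr' ?_
  filter_upwards [Ioo_mem_nhdsGT (show (0:ℝ) < 1 - s by linarith [hs.2])] with ε hε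
  rw [smul_eq_mul, hP.sub_eq (Ioo_subset_Icc_self hs) ⟨by linarith [hs.1, hε.1], by linarith [hε.2]⟩]

lemma k_mono (hG : IsFinslerEnergy n G ℓ α) (hΦ : IsRegularDomain n Φ δ₀)
    {x : H1Curve n 0 1} (hx : IsVCritical G Φ x) {a b : ℝ} (ha : LebPt (kfun G x (gradient Φ)) a)
    (hb : LebPt (kfun G x (gradient Φ)) b) (hab : a < b) :
    kfun G x (gradient Φ) a ≤ kfun G x (gradient Φ) b := by
  refine le_of_tendsto_of_tendsto ha.2 hb.2 ?_
  filter_upwards [Ioo_mem_nhdsGT (show (0:ℝ) < 1 - b by linarith [hb.1.2])] with ε hε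
  exact step_le hG hΦ hx ha.1.1 hab hε.1 (by linarith [hε.2])

lemma k_const (hG : IsFinslerEnergy n G ℓ α) (hΦ : IsRegularDomain n Φ δ₀)
    {x : H1Curve n 0 1} (hx : IsVCritical G Φ x) {a b s₀ : ℝ}
    (ha : LebPt (kfun G x (gradient Φ)) a)
    (hb : LebPt (kfun G x (gradient Φ)) b) (hab : a < b) (hs₀ : s₀ ≤ 1) (hb0 : b < s₀)
    (hc : ∀ s ∈ Ioo 0 s₀, Φ (x.toFun s) < 0) :
    kfun G x (gradient Φ) b ≤ kfun G x (gradient Φ) a := by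
  refine le_of_tendsto_of_tendsto hb.2 ha.2 ?_
  filter_upwards [Ioo_mem_nhdsGT (show (0:ℝ) < s₀ - b by linarith)] with ε hε
  exact step_ge hG hΦ hx ha.1.1 hab hε.1 (by linarith [hε.2]) hs₀ hc
end Grad


section Main
variable {n : ℕ} {G : Evec n → Evec n → ℝ} {ℓ α : ℝ} {Φ : Evec n → ℝ} {δ₀ : ℝ}

/-- Good points. -/
def Good (G : Evec n → Evec n → ℝ) (Φ : Evec n → ℝ) (x : H1Curve n 0 1) (s : ℝ) : Prop :=
  LebPt (kfun G x (gradient Φ)) s ∧ ∀ i : Fin n, kfun G x (Tf Φ (EuclideanSpace.single i 1)) s = 0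

lemma ae_good (hG : IsFinslerEnergy n G ℓ α) (hΦ : IsRegularDomain n Φ δ₀)
    {x : H1Curve n 0 1} (hx : IsVCritical G Φ x) : ∀ᵐ s, s ∈ Ioo (0:ℝ) 1 → Good G Φ x s := by
  have h1 : ∀ i : Fin n, ∀ᵐ s, s ∈ Icc (0:ℝ) 1 →
      kfun G x (Tf Φ (EuclideanSpace.single i 1)) s = 0 := fun i =>
    (ae_restrict_iff' measurableSet_Icc).1 (T_zero hG hΦ hx (EuclideanSpace.single i 1))
  filter_upwards [ae_all_iff.2 h1, ae_leb (k_int hG x (grad_cd hΦ))] with s h2 h3 h4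
  exact ⟨h3 h4, fun i => h2 i (Ioo_subset_Icc_self h4)⟩

/-- Primitive of the tangential zeroth order term. -/
def Ft (G : Evec n → Evec n → ℝ) (Φ : Evec n → ℝ) (x : H1Curve n 0 1) (i : Fin n) (s : ℝ) : ℝ :=
  ∫ r in (0:ℝ)..s, ffun G x (Tf Φ (EuclideanSpace.single i 1)) r

lemma good_eq {x : H1Curve n 0 1} {s : ℝ} (hs : Good G Φ x s) :
    ‖gradient Φ (x.toFun s)‖ ^ 2 • dvCLM G (x.toFun s) (x.deriv s) =
      (∑ i, Ft G Φ x i s • (EuclideanSpace.proj i : Evec n →L[ℝ] ℝ)) +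
      hfun G x (gradient Φ) s • innerSL ℝ (gradient Φ (x.toFun s)) := by
  have h1 : ∀ i, dvCLM G (x.toFun s) (x.deriv s) (Tf Φ (EuclideanSpace.single i 1) (x.toFun s)) =
      Ft G Φ x i s := by
    intro i
    have := hs.2 i
    unfold kfun at this
    exact sub_eq_zero.1 this
  refine ContinuousLinearMap.coe_injective ((EuclideanSpace.basisFun (Fin n) ℝ).toBasis.ext fun j => ?_)
  simp only [OrthonormalBasis.coe_toBasis, EuclideanSpace.basisFun_apply, ContinuousLinearMap.coe_coe,
    _root_.add_apply, _root_.smul_apply, FunLike.coe_sum, Finset.sum_apply,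
    innerSL_apply_apply, smul_eq_mul, PiLp.proj_apply, hfun]
  have h2 : ∑ i, Ft G Φ x i s * (EuclideanSpace.single j (1:ℝ) : Evec n) i = Ft G Φ x j s := by
    simp [Pi.single_apply]
  rw [h2, ← h1 j]
  unfold Tf
  simp only [map_sub, map_smul, smul_eq_mul]
  ring

lemma Ft_prim (hG : IsFinslerEnergy n G ℓ α) (hΦ : IsRegularDomain n Φ δ₀) (x : H1Curve n 0 1) 
    (i : Fin n) : ContinuousOn (Ft G Φ x i) (Icc 0 1) :=
  (F_prim hG x (Tf_cd hΦ _)).continuousOn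

lemma Phi_neg (hΦ : IsRegularDomain n Φ δ₀) {x : H1Curve n 0 1} (h0 : Φ (x.toFun 0) = 0) {s₀ : ℝ}
    (hs₀ : s₀ ≤ 1)
    (h : ∀ᵐ s, s ∈ Ioo 0 s₀ → ⟪gradient Φ (x.toFun s), x.deriv s⟫ < 0) :
    ∀ s ∈ Ioo 0 s₀, Φ (x.toFun s) < 0 := by
  intro t ht
  have hP := (x_prim x).chain (g := Φ) (hΦ.smooth.of_le (by norm_num))
  have h1 := hP.2 t ⟨ht.1.le, ht.2.le.trans hs₀⟩
  have he : ∀ s, fderiv ℝ Φ (x.toFun s) (x.deriv s) = ⟪gradient Φ (x.toFun s), x.deriv s⟫ := by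
    intro s
    unfold gradient
    rw [InnerProductSpace.toDual_symm_apply]
  beta_reduce at h1
  rw [h0, zero_add, intervalIntegral.integral_of_le ht.1.le] at h1
  rw [h1]
  have hi : IntegrableOn (fun s => fderiv ℝ Φ (x.toFun s) (x.deriv s)) (Ioc 0 t) :=
    hP.1.mono_set (fun s hs => ⟨hs.1.le, hs.2.trans (ht.2.le.trans hs₀)⟩)
  have hneg : ∀ᵐ s ∂(volume.restrict (Ioc 0 t)), fderiv ℝ Φ (x.toFun s) (x.deriv s) < 0 := by
    rw [ae_restrict_iff' measurableSet_Ioc]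
    filter_upwards [h] with s hs hs'
    rw [he]; exact hs ⟨hs'.1, hs'.2.trans_lt ht.2⟩
  have hle : ∫ s in Ioc 0 t, fderiv ℝ Φ (x.toFun s) (x.deriv s) ≤ 0 :=
    integral_nonpos_of_ae (hneg.mono fun s hs => hs.le)
  refine lt_of_le_of_ne hle fun h2 => ?_
  have h3 : ∫ s in Ioc 0 t, -fderiv ℝ Φ (x.toFun s) (x.deriv s) = 0 := by
    rw [integral_neg, h2, neg_zero]
  replace h3 := (integral_eq_zero_iff_of_nonneg_ae
    (f := fun s => -fderiv ℝ Φ (x.toFun s) (x.deriv s))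
    (hneg.mono fun s hs => by simpa using hs.le) hi.neg).1 h3
  have h4 : ∀ᵐ s ∂(volume.restrict (Ioc 0 t)), False := by
    filter_upwards [h3, hneg] with s h5 h6
    simp at h5
    exact h6.ne h5
  have h5 : volume.restrict (Ioc 0 t) = 0 := by
    rwa [eventually_false_iff_eq_bot, ae_eq_bot] at h4
  rw [Measure.restrict_eq_zero, Real.volume_Ioc] at h5
  simp at h5
  linarith [ht.1]

/-- The filter of points tending to `0` from the right, up to null sets. -/
def Lf : Filter ℝ := nhdsWithin 0 (Ioi 0) ⊓ ae volume

lemma Lf_neBot : Lf.NeBot := by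
  unfold Lf
  rw [inf_neBot_iff]
  intro s hs t ht
  obtain ⟨u, hu, hus⟩ := mem_nhdsGT_iff_exists_Ioo_subset.1 hs
  by_contra hne
  rw [not_nonempty_iff_eq_empty] at hne
  have h1 : Ioo 0 u ⊆ tᶜ := fun r hr hrt => by
    have : r ∈ s ∩ t := ⟨hus hr, hrt⟩
    rw [hne] at this; exact this
  have h2 : volume (Ioo 0 u) = 0 := measure_mono_null h1 ht
  rw [Real.volume_Ioo] at h2
  simp at h2
  exact absurd hu (not_lt.2 h2)

lemma Lf_good (hG : IsFinslerEnergy n G ℓ α) (hΦ : IsRegularDomain n Φ δ₀)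
    {x : H1Curve n 0 1} (hx : IsVCritical G Φ x) : ∀ᶠ s in Lf, Good G Φ x s := by
  have h1 : ∀ᶠ s in Lf, s ∈ Ioo (0:ℝ) 1 := mem_inf_of_left (Ioo_mem_nhdsGT one_pos)
  have h2 : ∀ᶠ s in Lf, s ∈ Ioo (0:ℝ) 1 → Good G Φ x s := mem_inf_of_right (ae_good hG hΦ hx)
  filter_upwards [h1, h2] with s h3 h4 using h4 h3

lemma Lf_tendsto {X : Type*} [TopologicalSpace X] {f : ℝ → X} (hf : ContinuousOn f (Icc 0 1)) :
    Tendsto f Lf (nhds (f 0)) := by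
  have h := hf 0 (by simp)
  refine Tendsto.mono_left h (inf_le_left.trans ?_)
  rw [nhdsWithin_le_iff]
  exact Icc_mem_nhdsGT one_pos

lemma k_bdd (hG : IsFinslerEnergy n G ℓ α) (hΦ : IsRegularDomain n Φ δ₀)
    {x : H1Curve n 0 1} (hx : IsVCritical G Φ x) :
    ∃ B, ∀ s, Good G Φ x s → -B ≤ kfun G x (gradient Φ) s := by
  by_contra hcon
  push Not at hcon
  have hα := hG.alpha_pos
  have hl := hG.one_le_ell
  -- constants
  have hFt : ∀ i : Fin n, ∃ C, ∀ s ∈ Icc (0:ℝ) 1, ‖Ft G Φ x i s‖ ≤ C := fun i =>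
    isCompact_Icc.exists_bound_of_continuousOn (Ft_prim hG hΦ x i)
  choose C hC using hFt
  have hC0 : ∀ i, 0 ≤ C i := fun i => (norm_nonneg _).trans (hC i 0 (by simp))
  set C1 := ∑ i, C i with hC1
  have hC10 : 0 ≤ C1 := Finset.sum_nonneg fun i _ => hC0 i
  obtain ⟨C2, hC2⟩ := isCompact_Icc.exists_bound_of_continuousOn (F_prim hG x (grad_cd hΦ)).continuousOn
  obtain ⟨C3, hC30, hC3⟩ := comp_bound x (grad_cd hΦ).continuous
  have hN0 : gradient Φ (x.toFun 0) ≠ 0 :=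
    hΦ.grad_ne_zero _ (by rw [hx.1.2.1, abs_zero]; exact hΦ.delta0_pos.le)
  obtain ⟨m, hm0, hm⟩ : ∃ m, 0 < m ∧ m < ‖gradient Φ (x.toFun 0)‖ ^ 2 :=
    exists_between (by positivity)
  have hNc : ContinuousOn (fun s => ‖gradient Φ (x.toFun s)‖ ^ 2) (Icc 0 1) :=
    (((grad_cd hΦ).continuous.comp_continuousOn (x_prim x).continuousOn).norm).pow 2
  obtain ⟨s₁, hs₁, hs₁m⟩ : ∃ s₁, 0 < s₁ ∧ ∀ s ∈ Ioo 0 s₁, m < ‖gradient Φ (x.toFun s)‖ ^ 2 := by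
    have h := (hNc 0 (by simp)).eventually (lt_mem_nhds hm)
    have h2 : nhdsWithin (0:ℝ) (Ioi 0) ≤ nhdsWithin 0 (Icc 0 1) := by
      rw [nhdsWithin_le_iff]
      exact Icc_mem_nhdsGT one_pos
    obtain ⟨u, hu, hus⟩ := mem_nhdsGT_iff_exists_Ioo_subset.1 (h2 h)
    exact ⟨u, hu, fun s hs => hus hs⟩
  set B := C2 + ℓ * C3 * (C1 / (m * α)) + 1 with hB
  obtain ⟨t, ht, htB⟩ := hcon B
  set s₀ := min t s₁ with hs₀
  have hs₀1 : s₀ ≤ 1 := (min_le_left _ _).trans ht.1.1.2.le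
  have hs₀p : 0 < s₀ := lt_min ht.1.1.1 hs₁
  have hneg : ∀ s ∈ Ioo 0 s₀, Good G Φ x s → ⟪gradient Φ (x.toFun s), x.deriv s⟫ < 0 := by
    intro s hs hgood
    by_contra hge
    rw [not_lt] at hge
    have hsI : s ∈ Icc (0:ℝ) 1 := Ioo_subset_Icc_self hgood.1.1
    have hk := k_mono hG hΦ hx hgood.1 ht.1 (hs.2.trans_le (min_le_left _ _))
    have hmm := hs₁m s ⟨hs.1, hs.2.trans_le (min_le_right _ _)⟩
    have hh : hfun G x (gradient Φ) s < - (ℓ * C3 * (C1 / (m * α)) + 1) := by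
      have e : hfun G x (gradient Φ) s = kfun G x (gradient Φ) s + ∫ r in (0:ℝ)..s, ffun G x (gradient Φ) r := by
        unfold kfun; ring
      have h1 := (abs_le.1 (hC2 s hsI)).2
      rw [e]; linarith
    have hpos : 0 ≤ ℓ * C3 * (C1 / (m * α)) := by positivity
    have e1 := congrArg (fun A : Evec n →L[ℝ] ℝ => A (x.deriv s)) (good_eq hgood)
    simp only [_root_.add_apply, _root_.smul_apply, FunLike.coe_sum, Finset.sum_apply,
      innerSL_apply_apply, smul_eq_mul, PiLp.proj_apply] at e1
    have e2 : ∑ i, Ft G Φ x i s * (x.deriv s) i ≤ C1 * ‖x.deriv s‖ := by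
      rw [hC1, Finset.sum_mul]
      refine Finset.sum_le_sum fun i _ => ?_
      refine (le_abs_self _).trans ?_
      rw [abs_mul]
      exact mul_le_mul (hC i s hsI) (by simpa [Real.norm_eq_abs] using PiLp.norm_apply_le (x.deriv s) i) (abs_nonneg _) (hC0 i)
    have e3 := dv_self hG (x.toFun s) (x.deriv s)
    have e4 : m * (α * ‖x.deriv s‖ ^ 2) ≤ C1 * ‖x.deriv s‖ := by
      calc m * (α * ‖x.deriv s‖ ^ 2) ≤ ‖gradient Φ (x.toFun s)‖ ^ 2 *
            dvCLM G (x.toFun s) (x.deriv s) (x.deriv s) := by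
            refine mul_le_mul hmm.le e3 (by positivity) (by positivity)
        _ ≤ C1 * ‖x.deriv s‖ := by
            rw [e1]
            have := mul_nonpos_of_nonpos_of_nonneg (show hfun G x (gradient Φ) s ≤ 0 by linarith) hge
            linarith
    have e5 : ‖x.deriv s‖ ≤ C1 / (m * α) := by
      rw [le_div_iff₀ (by positivity)]
      rcases (norm_nonneg (x.deriv s)).eq_or_lt with h | h
      · rw [← h]; simpa using hC10
      · refine le_of_mul_le_mul_right ?_ h
        nlinarith [e4]
    have e6 : |hfun G x (gradient Φ) s| ≤ ℓ * ‖x.deriv s‖ * C3 := by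
      change ‖dvCLM G (x.toFun s) (x.deriv s) (gradient Φ (x.toFun s))‖ ≤ _
      refine (ContinuousLinearMap.le_opNorm _ _).trans ?_
      exact mul_le_mul (dv_norm_le hG _ _) (hC3 s hsI) (norm_nonneg _) (by positivity)
    have e7 : ℓ * ‖x.deriv s‖ * C3 ≤ ℓ * (C1 / (m * α)) * C3 := by gcongr
    have e8 := (abs_le.1 (e6.trans e7)).1
    nlinarith
  have hc := Phi_neg hΦ hx.1.2.1 hs₀1 (by
    filter_upwards [ae_good hG hΦ hx] with s h1 h2
    exact hneg s h2 (h1 ⟨h2.1, h2.2.trans_le hs₀1⟩))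
  have : Lf.NeBot := Lf_neBot
  obtain ⟨r, hr, hrg⟩ : ∃ r, r ∈ Ioo 0 s₀ ∧ Good G Φ x r :=
    ((show ∀ᶠ s in Lf, s ∈ Ioo 0 s₀ from mem_inf_of_left (Ioo_mem_nhdsGT hs₀p)).and
      (Lf_good hG hΦ hx)).exists
  obtain ⟨r', hr', hlt⟩ := hcon (-kfun G x (gradient Φ) r)
  rw [neg_neg] at hlt
  rcases lt_trichotomy r r' with h | h | h
  · exact absurd (k_mono hG hΦ hx hrg.1 hr'.1 h) (not_le.2 hlt)
  · rw [h] at hlt; exact lt_irrefl _ hlt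
  · exact absurd (k_const hG hΦ hx hr'.1 hrg.1 h hs₀1 hr.2 hc) (not_le.2 hlt)

lemma k_lim (hG : IsFinslerEnergy n G ℓ α) (hΦ : IsRegularDomain n Φ δ₀)
    {x : H1Curve n 0 1} (hx : IsVCritical G Φ x) :
    ∃ k₀, Tendsto (kfun G x (gradient Φ)) Lf (nhds k₀) := by
  obtain ⟨B, hB⟩ := k_bdd hG hΦ hx
  have : Lf.NeBot := Lf_neBot
  let S := kfun G x (gradient Φ) '' {s | Good G Φ x s}
  have hbb : BddBelow S := ⟨-B, by rintro _ ⟨s, hs, rfl⟩; exact hB s hs⟩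
  have hne : S.Nonempty := by
    obtain ⟨s, hs⟩ := (Lf_good hG hΦ hx).exists
    exact ⟨_, s, hs, rfl⟩
  refine ⟨sInf S, tendsto_order.2 ⟨fun a ha => ?_, fun a ha => ?_⟩⟩
  · filter_upwards [Lf_good hG hΦ hx] with s hs
    exact ha.trans_le (csInf_le hbb ⟨s, hs, rfl⟩)
  · obtain ⟨_, ⟨t, ht, rfl⟩, hta⟩ := exists_lt_of_csInf_lt hne ha
    filter_upwards [Lf_good hG hΦ hx,
      (show ∀ᶠ s in Lf, s ∈ Ioo 0 t from mem_inf_of_left (Ioo_mem_nhdsGT ht.1.1.1))] with s hs hst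
    exact (k_mono hG hΦ hx hs.1 ht.1 hst.2).trans_lt hta

lemma end_zero (hG : IsFinslerEnergy n G ℓ α) (hΦ : IsRegularDomain n Φ δ₀)
    {x : H1Curve n 0 1} (hx : IsVCritical G Φ x) :
    ∃ d₀ : Evec n, HasDerivWithinAt x.toFun d₀ (Icc (0:ℝ) 1) 0 ∧
      (∀ w : Evec n, ⟪gradient Φ (x.toFun 0), w⟫ = 0 → dvCLM G (x.toFun 0) d₀ w = 0) := by
  have hα := hG.alpha_pos
  have hne : Lf.NeBot := Lf_neBot
  obtain ⟨k₀, hk₀⟩ := k_lim hG hΦ hx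
  have hN0 : gradient Φ (x.toFun 0) ≠ 0 :=
    hΦ.grad_ne_zero _ (by rw [hx.1.2.1, abs_zero]; exact hΦ.delta0_pos.le)
  have hxt : Tendsto x.toFun Lf (nhds (x.toFun 0)) := Lf_tendsto (x_prim x).continuousOn
  have hNt : Tendsto (fun s => gradient Φ (x.toFun s)) Lf (nhds (gradient Φ (x.toFun 0))) :=
    ((grad_cd hΦ).continuous.tendsto _).comp hxt
  have hN2 : Tendsto (fun s => ‖gradient Φ (x.toFun s)‖ ^ 2) Lf
      (nhds (‖gradient Φ (x.toFun 0)‖ ^ 2)) := hNt.norm.pow 2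
  have hN20 : ‖gradient Φ (x.toFun 0)‖ ^ 2 ≠ 0 := by positivity
  have hh : Tendsto (hfun G x (gradient Φ)) Lf (nhds k₀) := by
    have h1 := Lf_tendsto (F_prim hG x (grad_cd hΦ)).continuousOn
    have h2 := hk₀.add h1
    simp only [intervalIntegral.integral_same, add_zero] at h2
    refine h2.congr fun s => ?_
    unfold kfun; ring
  let p : ℝ → Evec n →L[ℝ] ℝ := fun s => dvCLM G (x.toFun s) (x.deriv s)
  have hF : ∀ i, Tendsto (Ft G Φ x i) Lf (nhds 0) := by
    intro i
    have h1 := Lf_tendsto (Ft_prim hG hΦ x i)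
    simpa [Ft] using h1
  let p₀ : Evec n →L[ℝ] ℝ := (‖gradient Φ (x.toFun 0)‖ ^ 2)⁻¹ •
    ((∑ i, (0:ℝ) • (EuclideanSpace.proj i : Evec n →L[ℝ] ℝ)) +
      k₀ • innerSL ℝ (gradient Φ (x.toFun 0)))
  have hp : Tendsto p Lf (nhds p₀) := by
    have h1 : Tendsto (fun s => (‖gradient Φ (x.toFun s)‖ ^ 2)⁻¹ •
      ((∑ i, Ft G Φ x i s • (EuclideanSpace.proj i : Evec n →L[ℝ] ℝ)) +
      hfun G x (gradient Φ) s • innerSL ℝ (gradient Φ (x.toFun s)))) Lf (nhds p₀) := by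
      refine (hN2.inv₀ hN20).smul (Tendsto.add ?_ ?_)
      · exact tendsto_finsetSum _ fun i _ => (hF i).smul_const _
      · exact hh.smul (((innerSL ℝ).continuous.tendsto _).comp hNt)
    refine h1.congr' ?_
    filter_upwards [Lf_good hG hΦ hx, hN2.eventually_ne hN20] with s hs hs2
    rw [← good_eq hs, smul_smul, inv_mul_cancel₀ hs2, one_smul]
  have hbd : ∀ᶠ s in Lf, x.deriv s ∈ Metric.closedBall (0 : Evec n) ((‖p₀‖ + 1) / α) := by
    filter_upwards [hp.norm.eventually (gt_mem_nhds (lt_add_one ‖p₀‖))] with s hs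
    rw [mem_closedBall_zero_iff, le_div_iff₀ hα]
    have h1 := dv_self hG (x.toFun s) (x.deriv s)
    have h2 := (le_abs_self _).trans ((p s).le_opNorm (x.deriv s))
    rcases (norm_nonneg (x.deriv s)).eq_or_lt with h | h
    · rw [← h, zero_mul]; positivity
    · refine le_of_mul_le_mul_right ?_ h
      have h3 : ‖p s‖ * ‖x.deriv s‖ ≤ (‖p₀‖ + 1) * ‖x.deriv s‖ := by gcongr
      have h4 : α * ‖x.deriv s‖ ^ 2 ≤ ‖p s‖ * ‖x.deriv s‖ := h1.trans h2
      nlinarith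
  let U := Ultrafilter.of Lf
  have hU : (U : Filter ℝ) ≤ Lf := Ultrafilter.of_le Lf
  obtain ⟨d, -, hd⟩ := (isCompact_closedBall (0 : Evec n) ((‖p₀‖ + 1) / α)).ultrafilter_le_nhds
    (U.map x.deriv) (by rw [le_principal_iff]; exact hU hbd)
  have hd' : Tendsto x.deriv U (nhds d) := hd
  have hpd : dvCLM G (x.toFun 0) d = p₀ := by
    have h1 : Tendsto p U (nhds (dvCLM G (x.toFun 0) d)) :=
      ((dv_cont hG).tendsto (x.toFun 0, d)).comp ((hxt.mono_left hU).prodMk_nhds hd')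
    exact tendsto_nhds_unique h1 (hp.mono_left hU)
  have hv : Tendsto x.deriv Lf (nhds d) := by
    have h1 : Tendsto (fun s => dvCLM G (x.toFun s) d) Lf (nhds (dvCLM G (x.toFun 0) d)) :=
      ((dv_cont hG).tendsto (x.toFun 0, d)).comp (hxt.prodMk_nhds tendsto_const_nhds)
    have h2 : Tendsto (fun s => α⁻¹ * ‖p s - dvCLM G (x.toFun s) d‖) Lf (nhds 0) := by
      have h3 := ((hp.sub h1).norm).const_mul α⁻¹
      rwa [hpd, sub_self, norm_zero, mul_zero] at h3
    rw [tendsto_iff_norm_sub_tendsto_zero]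
    refine squeeze_zero (fun s => norm_nonneg _) (fun s => ?_) h2
    have h4 := dv_mono hG (x.toFun s) (x.deriv s) d
    have h5 := h4.trans ((Real.le_norm_self _).trans (ContinuousLinearMap.le_opNorm _ _))
    rw [le_inv_mul_iff₀ hα]
    rcases (norm_nonneg (x.deriv s - d)).eq_or_lt with h | h
    · rw [← h, mul_zero]; positivity
    · refine le_of_mul_le_mul_right ?_ h
      refine le_trans (le_of_eq ?_) h5
      ring
  refine ⟨d, ?_, ?_⟩
  · have h1 : HasDerivWithinAt (fun u => ∫ r in (0:ℝ)..u, x.deriv r) d (Ici 0) 0 :=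
      intervalIntegral.integral_hasDerivWithinAt_of_tendsto_ae_right (t := Ioi 0) (by simp)
        ⟨Icc 0 1, Icc_mem_nhdsGT one_pos, x.deriv_integrable.1⟩ hv
    refine ((h1.mono Icc_subset_Ici_self).const_add (x.toFun 0)).congr (fun t ht => ?_) (by simp)
    exact x.eq_add_integral t ht
  · intro w hw
    rw [hpd]
    simp [p₀, hw]
end Main


section Rev
variable {n : ℕ} {G : Evec n → Evec n → ℝ} {ℓ α : ℝ} {Φ : Evec n → ℝ} {δ₀ : ℝ}

lemma fderiv_neg_arg (f : Evec n → ℝ) (x : Evec n) :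
    fderiv ℝ (fun u => f (-u)) x = -fderiv ℝ f (-x) := by
  have h := (ContinuousLinearEquiv.neg ℝ (M := Evec n)).comp_right_fderiv (f := f) (x := x)
  have h' : fderiv ℝ (fun u => f (-u)) x = (fderiv ℝ f (-x)).comp
    ((ContinuousLinearEquiv.neg ℝ (M := Evec n) : Evec n ≃L[ℝ] Evec n) : Evec n →L[ℝ] Evec n) := h
  rw [h']
  ext w
  simp

/-- The reversed energy. -/
def revG (G : Evec n → Evec n → ℝ) : Evec n → Evec n → ℝ := fun q v => G q (-v)

lemma dv_rev (q v : Evec n) : dvCLM (revG G) q v = -dvCLM G q (-v) := by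
  unfold dvCLM revG
  exact fderiv_neg_arg (fun w => G q w) v

lemma dq_rev (q v : Evec n) : dqCLM (revG G) q v = dqCLM G q (-v) := rfl

lemma rev_energy (hG : IsFinslerEnergy n G ℓ α) : IsFinslerEnergy n (revG G) ℓ α where
  continuous := by
    exact hG.continuous.comp (show Continuous fun p : Evec n × Evec n => (p.1, -p.2) by fun_prop)
  smooth := by
    refine hG.smooth.comp (f := fun p : Evec n × Evec n => (p.1, -p.2)) (s := {p | p.2 ≠ 0})
      (ContDiff.contDiffOn (by fun_prop)) ?_
    intro p hp
    simpa using hp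
  homog := by
    intro q v lam hlam
    simp only [revG, ← smul_neg]
    exact hG.homog q (-v) lam hlam
  one_le_ell := hG.one_le_ell
  alpha_pos := hG.alpha_pos
  lower := fun q v => by simpa [revG] using hG.lower q (-v)
  upper := fun q v => by simpa [revG] using hG.upper q (-v)
  dq_bound := fun q v => by simpa [dq_rev] using hG.dq_bound q (-v)
  dv_bound := fun q v => by simpa [dv_rev] using hG.dv_bound q (-v)
  vv_convex := by
    intro q v hv w
    have h1 : (fun u => dvCLM (revG G) q u w) = fun u => -(fun u => dvCLM G q u w) (-u) := by
      funext u; rw [dv_rev]; rfl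
    rw [h1, fderiv_fun_neg, fderiv_neg_arg (fun u => dvCLM G q u w), neg_neg]
    exact hG.vv_convex q (-v) (neg_ne_zero.2 hv) w

lemma mem_rev {t : ℝ} (ht : t ∈ Icc (0:ℝ) 1) : 1 - t ∈ Icc (0:ℝ) 1 :=
  ⟨by linarith [ht.2], by linarith [ht.1]⟩

lemma intOn_rev {E : Type*} [NormedAddCommGroup E] {f : ℝ → E}
    (h : IntegrableOn f (Icc (0:ℝ) 1)) : IntegrableOn (fun s => f (1 - s)) (Icc (0:ℝ) 1) := by
  have h1 : IntervalIntegrable f volume 0 1 := by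
    rw [intervalIntegrable_iff_integrableOn_Icc_of_le zero_le_one]; exact h
  have h2 := (h1.comp_sub_left 1).symm
  simp only [sub_zero, sub_self] at h2
  rwa [intervalIntegrable_iff_integrableOn_Icc_of_le zero_le_one] at h2

/-- The reversed curve. -/
def revC (x : H1Curve n 0 1) : H1Curve n 0 1 where
  toFun := fun s => x.toFun (1 - s)
  deriv := fun s => -x.deriv (1 - s)
  deriv_integrable := (intOn_rev x.deriv_integrable).neg
  deriv_sq_integrable := by
    have := intOn_rev x.deriv_sq_integrable
    simpa using this
  eq_add_integral := by
    intro t ht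
    rw [intervalIntegral.integral_neg, intervalIntegral.integral_comp_sub_left (fun s => x.deriv s) 1,
      ← (x_prim x).sub_eq (mem_rev ht) (mem_rev (by simp))]
    abel

lemma dJ_rev (x ξ : H1Curve n 0 1) : dJ (revG G) (revC x) ξ = dJ G x (revC ξ) := by
  unfold dJ
  congr 1
  have h := intervalIntegral.integral_comp_sub_left (a := 0) (b := 1)
    (fun s => dqCLM G (x.toFun s) (x.deriv s) ((revC ξ).toFun s) +
      dvCLM G (x.toFun s) (x.deriv s) ((revC ξ).deriv s)) 1
  simp only [sub_zero, sub_self] at h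
  rw [← h]
  refine intervalIntegral.integral_congr fun s _ => ?_
  simp [revC, dv_rev, dq_rev]

lemma rev_crit {x : H1Curve n 0 1} (hx : IsVCritical G Φ x) :
    IsVCritical (revG G) Φ (revC x) := by
  refine ⟨⟨fun s hs => hx.1.1 _ (mem_rev hs), by simpa [revC] using hx.1.2.2,
    by simpa [revC] using hx.1.2.1⟩, fun ξ hξ => ?_⟩
  rw [dJ_rev]
  refine hx.2 _ ⟨by simpa [revC] using hξ.2.1, by simpa [revC] using hξ.1, fun s hs h0 => ?_⟩
  have := hξ.2.2 (1 - s) ⟨by linarith [hs.2], by linarith [hs.1]⟩ (by simpa [revC] using h0)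
  simpa [revC] using this

lemma end_one (hG : IsFinslerEnergy n G ℓ α) (hΦ : IsRegularDomain n Φ δ₀)
    {x : H1Curve n 0 1} (hx : IsVCritical G Φ x) :
    ∃ d₁ : Evec n, HasDerivWithinAt x.toFun d₁ (Icc (0:ℝ) 1) 1 ∧
      (∀ w : Evec n, ⟪gradient Φ (x.toFun 1), w⟫ = 0 → dvCLM G (x.toFun 1) d₁ w = 0) := by
  obtain ⟨d, h1, h2⟩ := end_zero (rev_energy hG) hΦ (rev_crit hx)
  refine ⟨-d, ?_, fun w hw => ?_⟩
  · have h3 : HasDerivWithinAt (fun s : ℝ => 1 - s) (-1) (Icc (0:ℝ) 1) 1 := by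
      simpa using ((hasDerivAt_id (1:ℝ)).const_sub 1).hasDerivWithinAt
    have h4 := HasDerivWithinAt.scomp_of_eq (h := fun s : ℝ => 1 - s) (1:ℝ) h1 h3
      (fun s hs => mem_rev hs) (by simp)
    have h5 : ((revC x).toFun ∘ fun s : ℝ => 1 - s) = x.toFun := by
      funext s; simp [revC]
    rw [h5] at h4
    simpa using h4
  · have h3 := h2 w (by simpa [revC] using hw)
    rw [dv_rev] at h3
    simpa [revC] using h3
end Rev


/-- A non-constant `V⁻`-critical curve `x` of `J` on `Mf` is differentiable at the endpoints
and `ẋ(0)`, `ẋ(1)` are orthogonal to `∂Ω` in the Finsler sense: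
`d_vG(x(i),ẋ(i))[w] = 0` for every `w` tangent to `∂Ω` at `x(i)`, `i = 0,1`. -/
theorem stmt_11 {n : ℕ} (G : Evec n → Evec n → ℝ) (ℓ α : ℝ)
    (hG : IsFinslerEnergy n G ℓ α)
    (Φ : Evec n → ℝ) (δ₀ : ℝ) (hΦ : IsRegularDomain n Φ δ₀)
    (x : H1Curve n 0 1) (hx : IsVCritical G Φ x)
    (hnc : ¬ ∃ c : Evec n, ∀ s ∈ Icc (0:ℝ) 1, x.toFun s = c) :
    ∃ d₀ d₁ : Evec n,
      HasDerivWithinAt x.toFun d₀ (Icc (0:ℝ) 1) 0 ∧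
      HasDerivWithinAt x.toFun d₁ (Icc (0:ℝ) 1) 1 ∧
      (∀ w : Evec n, ⟪gradient Φ (x.toFun 0), w⟫ = 0 → dvCLM G (x.toFun 0) d₀ w = 0) ∧
      (∀ w : Evec n, ⟪gradient Φ (x.toFun 1), w⟫ = 0 → dvCLM G (x.toFun 1) d₁ w = 0) := by
  obtain ⟨d₀, h1, h2⟩ := end_zero hG hΦ hx
  obtain ⟨d₁, h3, h4⟩ := end_one hG hΦ hx
  exact ⟨d₀, d₁, h1, h3, h2, h4⟩

end
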